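/- Assume b is outer. Then for every λ ∈ D, the function b·k_λ is cyclic for S_b. -/

import Mathlib

open MeasureTheory Complex Filter Set Metric
open scoped ComplexConjugate

noncomputable section

/-- The circle group `ℝ / 2πℤ`, parametrizing the unit circle `𝕋`. -/
instance fact_two_pi_pos : Fact (0 < 2 * Real.pi) := ⟨by positivity⟩

abbrev Tc : Type := AddCircle (2 * Real.pi)

/-- Normalized Lebesgue measure on the circle. -/
def m : Measure Tc := AddCircle.haarAddCircle

instance : IsProbabilityMeasure m := by unfold m; infer_instance

/-- The point `e^{iθ}` of the unit circle corresponding to `θ ∈ ℝ/2πℤ`. -/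
def bd (θ : Tc) : ℂ := (AddCircle.toCircle θ : ℂ)

/-- The open unit disc. -/
abbrev uDisc : Set ℂ := Metric.ball (0 : ℂ) 1

/-- A function holomorphic on the open unit disc. -/
def HolDisc (f : ℂ → ℂ) : Prop := DifferentiableOn ℂ f uDisc

/-- `F` is the radial (a.e.) boundary function of `f`. -/
def IsBdry (f : ℂ → ℂ) (F : Tc → ℂ) : Prop :=
  ∀ᵐ θ ∂m, Tendsto (fun r : ℝ => f ((r : ℂ) * bd θ)) (nhdsWithin 1 (Set.Iio 1)) (nhds (F θ))

/-- Membership in the Hardy space `H^p` of the unit disc, `0 < p < ∞`. -/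
def MemHp (p : ℝ) (f : ℂ → ℂ) : Prop :=
  HolDisc f ∧ ∃ C : ℝ, ∀ r : ℝ, 0 ≤ r → r < 1 →
    (∫ θ : Tc, ‖f ((r : ℂ) * bd θ)‖ ^ p ∂m) ≤ C

/-- Membership in `H^∞`: bounded holomorphic functions on the disc. -/
def MemHinf (f : ℂ → ℂ) : Prop := HolDisc f ∧ ∃ C : ℝ, ∀ z ∈ uDisc, ‖f z‖ ≤ C

/-- Outer functions on the unit disc. -/
def OuterFn (f : ℂ → ℂ) : Prop :=
  HolDisc f ∧ ∃ (α : ℂ) (w : Tc → ℝ), ‖α‖ = 1 ∧ (∀ θ, 0 ≤ w θ) ∧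
    Integrable (fun θ => Real.log (w θ)) m ∧
    ∀ z ∈ uDisc,
      f z = α * Complex.exp (∫ θ : Tc, ((bd θ + z) / (bd θ - z)) * (Real.log (w θ) : ℂ) ∂m)

/-- Inner functions: `Θ` holomorphic bounded by one, with unimodular boundary values `Θs`. -/
def InnerFn (Θ : ℂ → ℂ) (Θs : Tc → ℂ) : Prop :=
  HolDisc Θ ∧ (∀ z ∈ uDisc, ‖Θ z‖ ≤ 1) ∧ IsBdry Θ Θs ∧ (∀ᵐ θ ∂m, ‖Θs θ‖ = 1)

/-- `L²(𝕋, m)`. -/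
abbrev L2 : Type := Lp ℂ 2 m

/-- The Hardy space `H²`, viewed inside `L²(𝕋)` as the functions whose negative
Fourier coefficients vanish. -/
def H2 : Set L2 := {F | ∀ n : ℤ, n < 0 → fourierCoeff (F : Tc → ℂ) n = 0}

/-- The Cauchy kernel `k_λ(z) = 1/(1 - conj(λ) z)`. -/
def ker (lam z : ℂ) : ℂ := (1 - conj lam * z)⁻¹

/-- Divergence of `Σ (1 - |λ_n|)` (for `λ_n` in the unit disc this is the negation of
the Blaschke condition). -/
def NotBlaschke (lam : ℕ → ℂ) : Prop := ¬ Summable (fun n => 1 - ‖lam n‖)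

/-- A bundle recording: a non-constant function `b` in the closed unit ball of `H^∞`
with `log(1 - |b|) ∈ L¹(𝕋)`, its Pythagorean mate `a` (outer, `a(0) > 0`,
`|a|² + |b|² = 1` a.e.), together with their boundary functions `bs`, `as'`. -/
structure BPair where
  b : ℂ → ℂ
  a : ℂ → ℂ
  bs : Tc → ℂ
  as' : Tc → ℂ
  b_hol : HolDisc b
  b_le_one : ∀ z ∈ uDisc, ‖b z‖ ≤ 1
  b_nonconst : ¬ ∃ c : ℂ, ∀ z ∈ uDisc, b z = c
  b_bdry : IsBdry b bs
  log_int : Integrable (fun θ => Real.log (1 - ‖bs θ‖)) m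
  a_outer : OuterFn a
  a_bdry : IsBdry a as'
  a0_pos : ∃ r : ℝ, 0 < r ∧ a 0 = (r : ℂ)
  pyth : ∀ᵐ θ ∂m, ‖as' θ‖ ^ 2 + ‖bs θ‖ ^ 2 = 1

/-- The defining relation of `H(b)`: `T_{conj b} F = T_{conj a} F⁺`, i.e. all nonnegative
Fourier coefficients of `conj(b)·F - conj(a)·F⁺` vanish, with `F, F⁺ ∈ H²`. -/
def HbMem (P : BPair) (F Fp : L2) : Prop :=
  F ∈ H2 ∧ Fp ∈ H2 ∧ ∀ n : ℤ, 0 ≤ n →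
    fourierCoeff (fun θ => conj (P.bs θ) * (F : Tc → ℂ) θ - conj (P.as' θ) * (Fp : Tc → ℂ) θ) n = 0

/-- The ambient Hilbert space `L² ×_2 L²` in which `H(b)` embeds isometrically via
`f ↦ (f, f⁺)`; its norm is `‖(F, F⁺)‖² = ‖F‖₂² + ‖F⁺‖₂²`, the `H(b)` norm. -/
abbrev HbP : Type := WithLp 2 (L2 × L2)

def fst2 (p : HbP) : L2 := ((WithLp.equiv 2 (L2 × L2)) p).1
def snd2 (p : HbP) : L2 := ((WithLp.equiv 2 (L2 × L2)) p).2

/-- The de Branges–Rovnyak space `H(b)`, as the set of pairs `(f, f⁺)`. -/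
def HbSet (P : BPair) : Set HbP := {p | HbMem P (fst2 p) (snd2 p)}

/-- `q` represents the element `φ · f` of `H(b)`, where `p` represents `f` and `φs` is a
boundary function: `q ∈ H(b)` and the first component of `q` is `φs` times that of `p`. -/
def MulRep (P : BPair) (φs : Tc → ℂ) (p q : HbP) : Prop :=
  q ∈ HbSet P ∧ (fst2 q : Tc → ℂ) =ᵐ[m] fun θ => φs θ * (fst2 p : Tc → ℂ) θ

/-- `Zf` is the family of elements `z^n·f`, `n ≥ 0`, of `H(b)`, where `p` represents `f`. -/
def ZFamily (P : BPair) (p : HbP) (Zf : ℕ → HbP) : Prop :=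
  ∀ n : ℕ, MulRep P (fun θ => (bd θ) ^ n) p (Zf n)

/-- `f` (represented by the pair `p`) is cyclic for `S_b`: the linear span of
`{z^n f : n ≥ 0}` is dense in `H(b)`. -/
def CyclicSb (P : BPair) (p : HbP) : Prop :=
  p ∈ HbSet P ∧ ∀ Zf : ℕ → HbP, ZFamily P p Zf →
    closure (↑(Submodule.span ℂ (Set.range Zf)) : Set HbP) = HbSet P

/-- `FK` is the family of elements `f·k_{λ_n}`, `n ≥ 0`, of `H(b)`. -/
def KFamily (P : BPair) (lam : ℕ → ℂ) (p : HbP) (FK : ℕ → HbP) : Prop :=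
  ∀ n : ℕ, MulRep P (fun θ => ker (lam n) (bd θ)) p (FK n)

/-- `C` is a bound for the norm of the shift `S_b` on `H(b)`. -/
def ShiftBound (P : BPair) (C : ℝ) : Prop :=
  0 ≤ C ∧ ∀ p q : HbP, p ∈ HbSet P → MulRep P (fun θ => bd θ) p q → ‖q‖ ≤ C * ‖p‖

/-- `N = ‖S_b‖`, the operator norm of the shift on `H(b)`. -/
def IsShiftNorm (P : BPair) (N : ℝ) : Prop :=
  ShiftBound P N ∧ ∀ C : ℝ, ShiftBound P C → N ≤ C

/-- `μ` is the Aleksandrov–Clark measure `μ_α` of `b`. -/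
def IsACMeasure (P : BPair) (α : ℂ) (μ : Measure Tc) : Prop :=
  IsFiniteMeasure μ ∧ ∀ z ∈ uDisc,
    (1 - ‖P.b z‖ ^ 2) / ‖1 - conj α * P.b z‖ ^ 2 = ∫ θ : Tc, (1 - ‖z‖ ^ 2) / ‖z - bd θ‖ ^ 2 ∂μ



theorem m_def : m = AddCircle.haarAddCircle := rfl

theorem continuous_bd : Continuous bd := by
  unfold bd
  exact continuous_subtype_val.comp AddCircle.continuous_toCircle

@[simp] theorem norm_bd (θ : Tc) : ‖bd θ‖ = 1 := Circle.norm_coe _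

theorem bd_ne_zero (θ : Tc) : bd θ ≠ 0 := by
  intro h; have := norm_bd θ; simp [h] at this

theorem integral_bd {E : Type*} [NormedAddCommGroup E] [NormedSpace ℝ E] (f : ℂ → E) :
    ∫ θ, f (bd θ) ∂m = Real.circleAverage f 0 1 := by
  rw [m_def, AddCircle.integral_haarAddCircle, Real.circleAverage_def,
    ← AddCircle.intervalIntegral_preimage (2 * Real.pi) 0]
  simp only [zero_add]
  congr 1
  apply intervalIntegral.integral_congr
  intro x _
  simp [bd, circleMap, AddCircle.toCircle_apply_mk]

theorem fourier_eq_bd (n : ℕ) (θ : Tc) : fourier (n : ℤ) θ = bd θ ^ n := by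
  rw [fourier_apply, natCast_zsmul, AddCircle.toCircle_nsmul]; rfl

theorem fourier_neg_eq_bd (n : ℕ) (θ : Tc) : fourier (-(n : ℤ)) θ = conj (bd θ ^ n) := by
  rw [fourier_neg, fourier_eq_bd]

/-- Herglotz kernel. -/
def Hk (z : ℂ) (θ : Tc) : ℂ := (bd θ + z) / (bd θ - z)

/-- Poisson kernel. -/
def Pk (z : ℂ) (θ : Tc) : ℝ := (Hk z θ).re

theorem bd_sub_norm {z : ℂ} (θ : Tc) : 1 - ‖z‖ ≤ ‖bd θ - z‖ := by
  have := norm_sub_norm_le (bd θ) z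
  simpa using this

theorem bd_sub_ne {z : ℂ} (hz : ‖z‖ < 1) (θ : Tc) : bd θ - z ≠ 0 := by
  have := bd_sub_norm (z := z) θ
  rw [← norm_pos_iff]; linarith

theorem norm_Hk_le {z : ℂ} (hz : ‖z‖ < 1) (θ : Tc) : ‖Hk z θ‖ ≤ 2 / (1 - ‖z‖) := by
  unfold Hk
  rw [norm_div]
  have h1 : ‖bd θ + z‖ ≤ 2 := by
    have := norm_add_le (bd θ) z
    simp at this; linarith
  have := bd_sub_norm (z := z) θ
  have : 0 < 1 - ‖z‖ := by linarith
  gcongr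

theorem continuous_Hk {z : ℂ} (hz : ‖z‖ < 1) : Continuous (Hk z) := by
  unfold Hk
  exact (continuous_bd.add continuous_const).div (continuous_bd.sub continuous_const)
    (bd_sub_ne hz)

theorem abs_Pk_le {z : ℂ} (hz : ‖z‖ < 1) (θ : Tc) : |Pk z θ| ≤ 2 / (1 - ‖z‖) :=
  (abs_re_le_norm _).trans (norm_Hk_le hz θ)

theorem Pk_eq (z : ℂ) (θ : Tc) : Pk z θ = (1 - ‖z‖ ^ 2) / ‖bd θ - z‖ ^ 2 := by
  have h := congrFun (poissonKernel_eq_re_herglotzRieszKernel (c := 0) (w := z)) (bd θ)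
  simp [poissonKernel_def, herglotzRieszKernel_def] at h
  rw [h]; rfl

theorem Pk_nonneg {z : ℂ} (hz : ‖z‖ < 1) (θ : Tc) : 0 ≤ Pk z θ := by
  rw [Pk_eq]
  have : ‖z‖ ^ 2 ≤ 1 := by nlinarith [norm_nonneg z]
  apply div_nonneg <;> [linarith; positivity]

theorem continuous_Pk {z : ℂ} (hz : ‖z‖ < 1) : Continuous (Pk z) :=
  continuous_re.comp (continuous_Hk hz)

theorem Pk_poly {z : ℂ} (hz : ‖z‖ < 1) (n : ℕ) : ∫ θ, (Pk z θ : ℂ) * bd θ ^ n ∂m = z ^ n := by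
  have h := DiffContOnCl.circleAverage_re_herglotzRieszKernel_smul (c := 0) (w := z) (R := 1)
    (f := fun z : ℂ => z ^ n) (Differentiable.diffContOnCl (by fun_prop)) (by simpa using hz)
  rw [← integral_bd] at h
  rw [← h]
  apply integral_congr_ae
  filter_upwards with θ
  simp [Pk, Hk, herglotzRieszKernel_def]

theorem Pk_conj_poly {z : ℂ} (hz : ‖z‖ < 1) (n : ℕ) :
    ∫ θ, (Pk z θ : ℂ) * conj (bd θ ^ n) ∂m = conj (z ^ n) := by
  rw [← Pk_poly hz, ← integral_conj]
  simp

theorem Pk_integral {z : ℂ} (hz : ‖z‖ < 1) : ∫ θ, Pk z θ ∂m = 1 := by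
  have := Pk_poly hz 0
  simp only [pow_zero, mul_one] at this
  have h2 : ∫ θ, (Pk z θ : ℂ) ∂m = ((∫ θ, Pk z θ ∂m : ℝ) : ℂ) := integral_ofReal
  rw [h2] at this
  exact_mod_cast this

theorem norm_mul_bd {r : ℝ} (h0 : 0 ≤ r) (θ : Tc) : ‖(r : ℂ) * bd θ‖ = r := by
  simp [abs_of_nonneg h0]

theorem norm_mul_bd_lt {r : ℝ} (h0 : 0 ≤ r) (h1 : r < 1) (θ : Tc) : ‖(r : ℂ) * bd θ‖ < 1 := by
  rwa [norm_mul_bd h0]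

theorem Pk_symm {r : ℝ} (h0 : 0 ≤ r) (θ t : Tc) : Pk (r * bd θ) t = Pk (r * bd t) θ := by
  rw [Pk_eq, Pk_eq, norm_mul_bd h0, norm_mul_bd h0]
  congr 1
  have e : ∀ a b : ℂ, ‖a‖ = 1 → ‖b‖ = 1 → ‖a - r * b‖ ^ 2 = 1 + r ^ 2 - 2 * r * (a.re * b.re + a.im * b.im) := by
    intro a b ha hb
    rw [← normSq_eq_norm_sq]
    have ha' : normSq a = 1 := by rw [normSq_eq_norm_sq, ha]; norm_num
    have hb' : normSq b = 1 := by rw [normSq_eq_norm_sq, hb]; norm_num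
    rw [normSq_apply] at *
    simp
    linear_combination ha' + r ^ 2 * hb'
  rw [e _ _ (norm_bd _) (norm_bd _), e _ _ (norm_bd _) (norm_bd _)]
  ring

/-- Poisson integral. -/
def Po (r : ℝ) (u : Tc → ℂ) (θ : Tc) : ℂ := ∫ t, (Pk (r * bd θ) t : ℂ) * u t ∂m

theorem Po_fourier {r : ℝ} (h0 : 0 ≤ r) (h1 : r < 1) (n : ℤ) (θ : Tc) :
    Po r (fourier n) θ = r ^ n.natAbs * fourier n θ := by
  unfold Po
  obtain ⟨k, rfl | rfl⟩ := n.eq_nat_or_neg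
  · simp only [fourier_eq_bd, Int.natAbs_natCast]
    rw [Pk_poly (norm_mul_bd_lt h0 h1 θ), mul_pow]
  · simp only [fourier_neg_eq_bd, Int.natAbs_neg, Int.natAbs_natCast]
    rw [Pk_conj_poly (norm_mul_bd_lt h0 h1 θ), mul_pow]
    simp

theorem Pk_mul_integrable {z : ℂ} (hz : ‖z‖ < 1) {u : Tc → ℂ} (hu : Integrable u m) :
    Integrable (fun t => (Pk z t : ℂ) * u t) m := by
  apply hu.bdd_mul (c := 2 / (1 - ‖z‖))
  · exact (continuous_ofReal.comp (continuous_Pk hz)).aestronglyMeasurable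
  · filter_upwards with t
    simpa using abs_Pk_le hz t

theorem continuous_Pk2 {r : ℝ} (h0 : 0 ≤ r) (h1 : r < 1) :
    Continuous (fun p : Tc × Tc => Pk (r * bd p.1) p.2) := by
  unfold Pk Hk
  have hb := continuous_bd
  refine continuous_re.comp (Continuous.div (by fun_prop) (by fun_prop) ?_)
  intro p
  exact bd_sub_ne (norm_mul_bd_lt h0 h1 _) _

theorem Po_prod_integrable {r : ℝ} (h0 : 0 ≤ r) (h1 : r < 1) {u : Tc → ℂ} (hu : Integrable u m) :
    Integrable (fun p : Tc × Tc => (Pk (r * bd p.1) p.2 : ℂ) * u p.2) (m.prod m) := by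
  apply (hu.comp_snd m).bdd_mul (c := 2 / (1 - r))
  · exact (continuous_ofReal.comp (continuous_Pk2 h0 h1)).aestronglyMeasurable
  · filter_upwards with p
    have := abs_Pk_le (norm_mul_bd_lt h0 h1 p.1) p.2
    rw [norm_mul_bd h0] at this
    simpa using this

theorem Po_integrable {r : ℝ} (h0 : 0 ≤ r) (h1 : r < 1) {u : Tc → ℂ} (hu : Integrable u m) :
    Integrable (Po r u) m := (Po_prod_integrable h0 h1 hu).integral_prod_left

theorem Po_contract {r : ℝ} (h0 : 0 ≤ r) (h1 : r < 1) {u : Tc → ℂ} (hu : Integrable u m) :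
    ∫ θ, ‖Po r u θ‖ ∂m ≤ ∫ θ, ‖u θ‖ ∂m := by
  have hP := (Po_prod_integrable h0 h1 hu)
  calc ∫ θ, ‖Po r u θ‖ ∂m ≤ ∫ θ, ∫ t, ‖(Pk (r * bd θ) t : ℂ) * u t‖ ∂m ∂m := by
        apply integral_mono (Po_integrable h0 h1 hu).norm hP.norm.integral_prod_left
        intro θ
        exact norm_integral_le_integral_norm _
    _ = ∫ t, ∫ θ, ‖(Pk (r * bd θ) t : ℂ) * u t‖ ∂m ∂m := integral_integral_swap hP.norm
    _ = ∫ θ, ‖u θ‖ ∂m := by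
        congr 1; ext t
        have : ∀ θ, ‖(Pk (r * bd θ) t : ℂ) * u t‖ = Pk (r * bd t) θ * ‖u t‖ := by
          intro θ
          rw [Pk_symm h0, norm_mul, norm_real, Real.norm_of_nonneg (Pk_nonneg (norm_mul_bd_lt h0 h1 _) _)]
        simp_rw [this]
        rw [integral_mul_const, Pk_integral (norm_mul_bd_lt h0 h1 _), one_mul]

theorem Po_sub {r : ℝ} (h0 : 0 ≤ r) (h1 : r < 1) {u v : Tc → ℂ} (hu : Integrable u m)
    (hv : Integrable v m) (θ : Tc) : Po r (fun t => u t - v t) θ = Po r u θ - Po r v θ := by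
  unfold Po
  rw [← integral_sub (Pk_mul_integrable (norm_mul_bd_lt h0 h1 _) hu)
    (Pk_mul_integrable (norm_mul_bd_lt h0 h1 _) hv)]
  simp only [mul_sub]

theorem Po_add {r : ℝ} (h0 : 0 ≤ r) (h1 : r < 1) {u v : Tc → ℂ} (hu : Integrable u m)
    (hv : Integrable v m) (θ : Tc) : Po r (fun t => u t + v t) θ = Po r u θ + Po r v θ := by
  unfold Po
  rw [← integral_add (Pk_mul_integrable (norm_mul_bd_lt h0 h1 _) hu)
    (Pk_mul_integrable (norm_mul_bd_lt h0 h1 _) hv)]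
  simp only [mul_add]

theorem Po_smul {r : ℝ} (c : ℂ) (u : Tc → ℂ) (θ : Tc) :
    Po r (fun t => c * u t) θ = c * Po r u θ := by
  unfold Po
  rw [← integral_const_mul]
  congr 1; ext t; ring

theorem cont_integrable {g : Tc → ℂ} (hg : Continuous g) : Integrable g m :=
  hg.integrable_of_hasCompactSupport (HasCompactSupport.of_compactSpace g)

theorem int_norm_sub {f g : Tc → ℂ} (hf : Integrable f m) (hg : Integrable g m) :
    Integrable (fun θ => ‖f θ - g θ‖) m := (hf.sub hg).norm

/-- A sequence of radii increasing to 1. -/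
def rs (j : ℕ) : ℝ := 1 - 1 / ((j : ℝ) + 2)

theorem rs_pos (j : ℕ) : 0 < rs j := by
  unfold rs
  have : (1 : ℝ) / (j + 2) < 1 := by
    rw [div_lt_one (by positivity)]; linarith [Nat.cast_nonneg (α := ℝ) j]
  linarith

theorem rs_nonneg (j : ℕ) : 0 ≤ rs j := (rs_pos j).le

theorem rs_lt (j : ℕ) : rs j < 1 := by
  unfold rs
  have : (0 : ℝ) < 1 / (j + 2) := by positivity
  linarith

theorem rs_tendsto : Tendsto rs atTop (nhds 1) := by
  have h := ((tendsto_one_div_add_atTop_nhds_zero_nat (𝕜 := ℝ)).comp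
    (tendsto_add_atTop_nat 1)).const_sub 1
  rw [sub_zero] at h
  refine h.congr fun j => ?_
  simp only [rs, Function.comp_apply]
  push_cast
  congr 2; ring

theorem rs_tendsto' : Tendsto rs atTop (nhdsWithin 1 (Set.Iio 1)) :=
  tendsto_nhdsWithin_iff.2 ⟨rs_tendsto, Eventually.of_forall rs_lt⟩

theorem Po_L1_span (g : C(Tc, ℂ)) (hg : g ∈ Submodule.span ℂ (range (@fourier (2 * Real.pi)))) :
    Tendsto (fun j => ∫ θ, ‖Po (rs j) g θ - g θ‖ ∂m) atTop (nhds 0) := by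
  induction hg using Submodule.span_induction with
  | mem g hg =>
    obtain ⟨n, rfl⟩ := hg
    have : ∀ j, ∫ θ, ‖Po (rs j) (fourier n) θ - fourier n θ‖ ∂m = ‖(rs j : ℂ) ^ n.natAbs - 1‖ := by
      intro j
      have : ∀ θ, ‖Po (rs j) (fourier n) θ - fourier n θ‖ = ‖(rs j : ℂ) ^ n.natAbs - 1‖ := by
        intro θ
        rw [Po_fourier (rs_nonneg j) (rs_lt j), ← sub_one_mul, norm_mul]
        have : ‖fourier n θ‖ = 1 := Circle.norm_coe _
        rw [this, mul_one]
      simp_rw [this]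
      simp
    simp_rw [this]
    have h : Tendsto (fun j => (rs j : ℂ)) atTop (nhds 1) := by
      exact_mod_cast (continuous_ofReal.tendsto 1).comp rs_tendsto
    simpa using ((h.pow n.natAbs).sub_const 1).norm
  | zero => simp [Po]
  | add x y _ _ hx hy =>
    have := hx.add hy
    simp only [add_zero] at this
    refine squeeze_zero (fun j => integral_nonneg fun _ => norm_nonneg _) (fun j => ?_) this
    have ix := int_norm_sub (Po_integrable (rs_nonneg j) (rs_lt j) (cont_integrable x.continuous))
      (cont_integrable x.continuous)
    have iy := int_norm_sub (Po_integrable (rs_nonneg j) (rs_lt j) (cont_integrable y.continuous))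
      (cont_integrable y.continuous)
    have ixy := int_norm_sub (Po_integrable (rs_nonneg j) (rs_lt j) (cont_integrable (x+y).continuous))
      (cont_integrable (x+y).continuous)
    rw [← integral_add ix iy]
    apply integral_mono ixy (ix.add iy)
    intro θ
    have := Po_add (rs_nonneg j) (rs_lt j) (cont_integrable x.continuous) (cont_integrable y.continuous) θ
    change ‖Po (rs j) (fun t => x t + y t) θ - (x θ + y θ)‖ ≤ ‖_‖ + ‖_‖
    rw [this]
    refine le_trans (le_of_eq ?_) (norm_add_le _ _)
    congr 1; ring
  | smul c x _ hx =>
    have : ∀ j, ∫ θ, ‖Po (rs j) (c • x) θ - (c • x) θ‖ ∂m = ‖c‖ * ∫ θ, ‖Po (rs j) x θ - x θ‖ ∂m := by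
      intro j
      rw [← integral_const_mul]
      congr 1; ext θ
      change ‖Po (rs j) (fun t => c * x t) θ - c * x θ‖ = _
      rw [Po_smul, ← mul_sub, norm_mul]
    have e : (fun j => ∫ θ, ‖Po (rs j) ⇑(c • x) θ - (c • x) θ‖ ∂m) = fun j => ‖c‖ * ∫ θ, ‖Po (rs j) x θ - x θ‖ ∂m := by
      ext j; exact this j
    rw [e]
    simpa using hx.const_mul ‖c‖

theorem Po_L1 {u : Tc → ℂ} (hu : Integrable u m) :
    Tendsto (fun j => ∫ θ, ‖Po (rs j) u θ - u θ‖ ∂m) atTop (nhds 0) := by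
  rw [Metric.tendsto_atTop]
  intro ε hε
  obtain ⟨g0, -, hg0, hg0c, hg0i⟩ := hu.exists_hasCompactSupport_integral_sub_le (ε := ε / 8) (by positivity)
  have hd : (⟨g0, hg0c⟩ : C(Tc, ℂ)) ∈ (Submodule.span ℂ (range (@fourier (2 * Real.pi)))).topologicalClosure := by
    rw [span_fourier_closure_eq_top]; trivial
  obtain ⟨g, hgs, hgd⟩ := Metric.mem_closure_iff.1 hd (ε / 8) (by positivity)
  have hgi := cont_integrable g.continuous
  have hug : ∫ θ, ‖u θ - g θ‖ ∂m ≤ ε / 4 := by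
    calc ∫ θ, ‖u θ - g θ‖ ∂m ≤ ∫ θ, (‖u θ - g0 θ‖ + ε / 8) ∂m := by
          apply integral_mono (int_norm_sub hu hgi) ((int_norm_sub hu hg0i).add (integrable_const _))
          intro θ
          have h1 : ‖g0 θ - g θ‖ ≤ ε / 8 := by
            have := (ContinuousMap.dist_apply_le_dist (f := (⟨g0, hg0c⟩ : C(Tc, ℂ))) (g := g) θ)
            rw [dist_eq_norm] at this
            exact this.trans hgd.le
          have := norm_sub_le_norm_sub_add_norm_sub (u θ) (g0 θ) (g θ)
          change _ ≤ ‖u θ - g0 θ‖ + ε / 8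
          linarith
      _ = (∫ θ, ‖u θ - g0 θ‖ ∂m) + ε / 8 := by
          rw [integral_add (int_norm_sub hu hg0i) (integrable_const _)]; simp
      _ ≤ ε / 4 := by linarith
  obtain ⟨N, hN⟩ := Metric.tendsto_atTop.1 (Po_L1_span g hgs) (ε / 4) (by positivity)
  refine ⟨N, fun j hj => ?_⟩
  have h2 := hN j hj
  rw [Real.dist_eq, sub_zero] at h2 ⊢
  rw [abs_of_nonneg (integral_nonneg fun _ => norm_nonneg _)] at h2 ⊢
  have hP := Po_contract (rs_nonneg j) (rs_lt j) (hu.sub hgi)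
  have hPi := Po_integrable (rs_nonneg j) (rs_lt j) (hu.sub hgi)
  have hPg := Po_integrable (rs_nonneg j) (rs_lt j) hgi
  have hPu := Po_integrable (rs_nonneg j) (rs_lt j) hu
  have : ∫ θ, ‖Po (rs j) u θ - u θ‖ ∂m ≤ ∫ θ, ‖Po (rs j) (u - g) θ‖ ∂m + ∫ θ, ‖Po (rs j) g θ - g θ‖ ∂m
      + ∫ θ, ‖u θ - g θ‖ ∂m := by
    have hs : Integrable (fun θ => ‖Po (rs j) (u - g) θ‖ + ‖Po (rs j) g θ - g θ‖) m :=
      hPi.norm.add (int_norm_sub hPg hgi)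
    rw [← integral_add hPi.norm (int_norm_sub hPg hgi), ← integral_add hs (int_norm_sub hu hgi)]
    apply integral_mono (int_norm_sub hPu hu) (hs.add (int_norm_sub hu hgi))
    intro θ
    have e : Po (rs j) (u - g) θ = _ := Po_sub (rs_nonneg j) (rs_lt j) hu hgi θ
    change ‖_‖ ≤ ‖Po (rs j) (u - g) θ‖ + ‖Po (rs j) g θ - g θ‖ + ‖u θ - g θ‖
    rw [e]
    have h1 := norm_add_le (Po (rs j) u θ - Po (rs j) g θ + (Po (rs j) g θ - g θ)) (-(u θ - g θ))
    have h3 := norm_add_le (Po (rs j) u θ - Po (rs j) g θ) (Po (rs j) g θ - g θ)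
    rw [norm_neg] at h1
    have : Po (rs j) u θ - u θ = Po (rs j) u θ - Po (rs j) g θ + (Po (rs j) g θ - g θ) + -(u θ - g θ) := by ring
    rw [this]
    linarith
  simp only [Pi.sub_apply] at hP
  linarith

/-- a.e. convergence along a subsequence. -/
theorem Po_ae {u : Tc → ℂ} (hu : Integrable u m) :
    ∃ ns : ℕ → ℕ, StrictMono ns ∧ ∀ᵐ θ ∂m, Tendsto (fun i => Po (rs (ns i)) u θ) atTop (nhds (u θ)) := by
  have h := Po_L1 hu
  have hm : TendstoInMeasure m (fun j => Po (rs j) u) atTop u := by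
    apply tendstoInMeasure_of_tendsto_eLpNorm (p := 1) one_ne_zero
    · intro j; exact (Po_integrable (rs_nonneg j) (rs_lt j) hu).aestronglyMeasurable
    · exact hu.aestronglyMeasurable
    · have : ∀ j, eLpNorm (Po (rs j) u - u) 1 m = ENNReal.ofReal (∫ θ, ‖Po (rs j) u θ - u θ‖ ∂m) := by
        intro j
        rw [eLpNorm_one_eq_lintegral_enorm, ← ofReal_integral_norm_eq_lintegral_enorm ((Po_integrable (rs_nonneg j) (rs_lt j) hu).sub hu)]
        rfl
      simp_rw [this]
      simpa using ENNReal.tendsto_ofReal h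
  exact hm.exists_seq_tendsto_ae


/-- Herglotz integral. -/
def Hz (u : Tc → ℝ) (z : ℂ) : ℂ := ∫ θ, Hk z θ * (u θ : ℂ) ∂m

theorem Hk_mul_integrable {z : ℂ} (hz : ‖z‖ < 1) {u : Tc → ℝ} (hu : Integrable u m) :
    Integrable (fun t => Hk z t * (u t : ℂ)) m := by
  apply hu.ofReal.bdd_mul (c := 2 / (1 - ‖z‖))
  · exact (continuous_Hk hz).aestronglyMeasurable
  · filter_upwards with t
    simpa using norm_Hk_le hz t

theorem Hz_re {z : ℂ} (hz : ‖z‖ < 1) {u : Tc → ℝ} (hu : Integrable u m) :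
    (Hz u z).re = ∫ θ, Pk z θ * u θ ∂m := by
  unfold Hz
  have := integral_re (Hk_mul_integrable hz hu)
  simp only [RCLike.re_to_complex] at this
  rw [← this]
  congr 1; ext θ
  simp [Pk]

theorem Hz_zero (u : Tc → ℝ) : Hz u 0 = ((∫ θ, u θ ∂m : ℝ) : ℂ) := by
  have h2 : ∫ θ, (u θ : ℂ) ∂m = ((∫ θ, u θ ∂m : ℝ) : ℂ) := integral_ofReal
  rw [← h2]
  unfold Hz
  congr 1; ext θ
  simp [Hk, bd_ne_zero]

theorem Hz_sub {z : ℂ} (hz : ‖z‖ < 1) {u v : Tc → ℝ} (hu : Integrable u m) (hv : Integrable v m) :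
    Hz (fun θ => u θ - v θ) z = Hz u z - Hz v z := by
  unfold Hz
  rw [← integral_sub (Hk_mul_integrable hz hu) (Hk_mul_integrable hz hv)]
  congr 1; ext θ
  push_cast; ring

theorem Pk_mul_integrable_real {z : ℂ} (hz : ‖z‖ < 1) {u : Tc → ℝ} (hu : Integrable u m) :
    Integrable (fun t => Pk z t * u t) m := by
  apply hu.bdd_mul (c := 2 / (1 - ‖z‖))
  · exact (continuous_Pk hz).aestronglyMeasurable
  · filter_upwards with t
    simpa using abs_Pk_le hz t

theorem Hz_re_mono {z : ℂ} (hz : ‖z‖ < 1) {u v : Tc → ℝ} (hu : Integrable u m) (hv : Integrable v m)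
    (h : ∀ᵐ θ ∂m, u θ ≤ v θ) : (Hz u z).re ≤ (Hz v z).re := by
  rw [Hz_re hz hu, Hz_re hz hv]
  apply integral_mono_ae (Pk_mul_integrable_real hz hu) (Pk_mul_integrable_real hz hv)
  filter_upwards [h] with θ hθ
  exact mul_le_mul_of_nonneg_left hθ (Pk_nonneg hz θ)

theorem Hz_const_re {z : ℂ} (hz : ‖z‖ < 1) (c : ℝ) : (Hz (fun _ => c) z).re = c := by
  rw [Hz_re hz (integrable_const c), integral_mul_const, Pk_integral hz, one_mul]

theorem Po_eq_Hz {r : ℝ} (h0 : 0 ≤ r) (h1 : r < 1) {u : Tc → ℝ} (hu : Integrable u m) (θ : Tc) :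
    Po r (fun t => (u t : ℂ)) θ = ((Hz u (r * bd θ)).re : ℂ) := by
  rw [Hz_re (norm_mul_bd_lt h0 h1 θ) hu]
  have h2 : ∫ t, ((Pk (r * bd θ) t * u t : ℝ) : ℂ) ∂m = ((∫ t, Pk (r * bd θ) t * u t ∂m : ℝ) : ℂ) :=
    integral_ofReal
  rw [← h2]
  unfold Po
  congr 1; ext t; push_cast; rfl

theorem Hz_diff {u : Tc → ℝ} (hu : Integrable u m) : DifferentiableOn ℂ (Hz u) uDisc := by
  intro z0 hz0
  have hz0' : ‖z0‖ < 1 := by simpa using hz0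
  apply DifferentiableAt.differentiableWithinAt
  set ρ := (1 + ‖z0‖) / 2 with hρ
  have hρ1 : ρ < 1 := by rw [hρ]; linarith
  have hball : ∀ z ∈ ball (0 : ℂ) ρ, ‖z‖ < ρ := by intro z hz; simpa using hz
  have key := hasDerivAt_integral_of_dominated_loc_of_deriv_le (μ := m) (𝕜 := ℂ)
    (F := fun z θ => Hk z θ * (u θ : ℂ))
    (F' := fun z θ => (2 * bd θ / (bd θ - z) ^ 2) * (u θ : ℂ))
    (s := ball (0 : ℂ) ρ) (x₀ := z0) (bound := fun θ => (2 / (1 - ρ) ^ 2) * |u θ|)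
    (isOpen_ball.mem_nhds (by simp [hρ]; linarith)) ?_ (Hk_mul_integrable hz0' hu) ?_ ?_
    (hu.norm.const_mul _) ?_
  · exact key.2.differentiableAt
  · filter_upwards [isOpen_ball.mem_nhds hz0] with z hz
    exact (Hk_mul_integrable (by simpa using hz) hu).aestronglyMeasurable
  · apply AEStronglyMeasurable.mul _ hu.ofReal.aestronglyMeasurable
    apply Continuous.aestronglyMeasurable
    exact (continuous_const.mul continuous_bd).div ((continuous_bd.sub continuous_const).pow 2)
      (fun θ => pow_ne_zero _ (bd_sub_ne hz0' θ))
  · filter_upwards with θ z hz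
    rw [norm_mul, norm_real, Real.norm_eq_abs]
    gcongr
    rw [norm_div, norm_mul, norm_pow, norm_bd]
    have h1 := bd_sub_norm (z := z) θ
    have h2 := hball z hz
    have h3 : 0 < 1 - ρ := by linarith
    simp only [Complex.norm_ofNat, mul_one]
    gcongr
    linarith
  · filter_upwards with θ z hz
    have hne := bd_sub_ne ((hball z hz).trans hρ1) θ
    apply HasDerivAt.mul_const
    unfold Hk
    have h1 : HasDerivAt (fun z => bd θ + z) 1 z := (hasDerivAt_id z).const_add _
    have h2 : HasDerivAt (fun z => bd θ - z) (-1) z := (hasDerivAt_id z).const_sub _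
    convert h1.div h2 hne using 1
    congr 1; ring

/-- Data attached to an outer function with boundary values bounded by one. -/
structure OD (φ : ℂ → ℂ) (φs : Tc → ℂ) (α : ℂ) (u : Tc → ℝ) : Prop where
  hol : HolDisc φ
  norm_α : ‖α‖ = 1
  int : Integrable u m
  rep : ∀ z ∈ uDisc, φ z = α * Complex.exp (Hz u z)
  bdry : IsBdry φ φs
  le_one : ∀ᵐ θ ∂m, ‖φs θ‖ ≤ 1

theorem exists_OD {φ : ℂ → ℂ} {φs : Tc → ℂ} (ho : OuterFn φ) (hb : IsBdry φ φs)
    (hle : ∀ᵐ θ ∂m, ‖φs θ‖ ≤ 1) : ∃ α u, OD φ φs α u := by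
  obtain ⟨hh, α, w, hα, -, hi, hr⟩ := ho
  exact ⟨α, fun θ => Real.log (w θ), hh, hα, hi, hr, hb, hle⟩

theorem mem_disc {z : ℂ} : z ∈ uDisc ↔ ‖z‖ < 1 := by simp

theorem OD.bdry_seq {φ : ℂ → ℂ} {φs : Tc → ℂ} {α : ℂ} {u : Tc → ℝ} (h : OD φ φs α u) :
    ∀ᵐ θ ∂m, Tendsto (fun j => φ (rs j * bd θ)) atTop (nhds (φs θ)) := by
  filter_upwards [h.bdry] with θ hθ
  exact hθ.comp rs_tendsto'

theorem OD.norm_eq {φ : ℂ → ℂ} {φs : Tc → ℂ} {α : ℂ} {u : Tc → ℝ} (h : OD φ φs α u) {z : ℂ}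
    (hz : ‖z‖ < 1) : ‖φ z‖ = Real.exp (Hz u z).re := by
  rw [h.rep z (mem_disc.2 hz), norm_mul, h.norm_α, one_mul, Complex.norm_exp]

theorem OD.u_le {φ : ℂ → ℂ} {φs : Tc → ℂ} {α : ℂ} {u : Tc → ℝ} (h : OD φ φs α u) :
    ∀ᵐ θ ∂m, u θ ≤ 0 := by
  obtain ⟨ns, hns, hae⟩ := Po_ae h.int.ofReal
  filter_upwards [hae, h.bdry_seq, h.le_one] with θ h1 h2 h3
  have h4 := (h2.comp hns.tendsto_atTop).norm
  have h5 : Tendsto (fun i => Real.exp (Hz u (rs (ns i) * bd θ)).re) atTop (nhds (Real.exp (u θ))) := by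
    apply (Real.continuous_exp.tendsto _).comp
    have := (continuous_re.tendsto _).comp h1
    simp only [Complex.coe_algebraMap, ofReal_re] at this
    refine this.congr fun i => ?_
    have := Po_eq_Hz (rs_nonneg (ns i)) (rs_lt (ns i)) h.int θ
    simp only [Function.comp_apply]
    erw [this]
    simp
  have h6 : ‖φs θ‖ = Real.exp (u θ) := by
    refine tendsto_nhds_unique h4 (h5.congr fun i => ?_)
    simp only [Function.comp_apply]
    rw [h.norm_eq (norm_mul_bd_lt (rs_nonneg _) (rs_lt _) _)]
  rw [h6] at h3
  simpa using h3

theorem OD.phi_le {φ : ℂ → ℂ} {φs : Tc → ℂ} {α : ℂ} {u : Tc → ℝ} (h : OD φ φs α u) {z : ℂ}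
    (hz : ‖z‖ < 1) : ‖φ z‖ ≤ 1 := by
  rw [h.norm_eq hz, Real.exp_le_one_iff, ← Hz_const_re hz 0]
  exact Hz_re_mono hz h.int (integrable_const _) h.u_le

theorem OD.cont_r {φ : ℂ → ℂ} {φs : Tc → ℂ} {α : ℂ} {u : Tc → ℝ} (h : OD φ φs α u) (j : ℕ) :
    Continuous (fun θ => φ (rs j * bd θ)) := by
  have := h.hol.continuousOn
  refine this.comp_continuous (continuous_const.mul continuous_bd) fun θ => ?_
  exact mem_disc.2 (norm_mul_bd_lt (rs_nonneg _) (rs_lt _) _)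

theorem OD.aesm {φ : ℂ → ℂ} {φs : Tc → ℂ} {α : ℂ} {u : Tc → ℝ} (h : OD φ φs α u) :
    AEStronglyMeasurable φs m :=
  aestronglyMeasurable_of_tendsto_ae atTop (fun j => (h.cont_r j).aestronglyMeasurable) h.bdry_seq

/-- continuity on the circle of a function holomorphic in a bigger disc -/
theorem cont_circ {f : ℂ → ℂ} {R : ℝ} (hR : 1 < R) (hf : DifferentiableOn ℂ f (ball 0 R)) :
    Continuous (fun θ => f (bd θ)) := by
  refine hf.continuousOn.comp_continuous continuous_bd fun θ => ?_
  simpa using hR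

theorem bdd_circ {f : Tc → ℂ} (hf : Continuous f) : ∃ C, ∀ θ, ‖f θ‖ ≤ C := by
  obtain ⟨C, hC⟩ := isCompact_univ.exists_bound_of_continuousOn hf.continuousOn
  exact ⟨C, fun θ => hC θ trivial⟩

theorem OD.mean {φ : ℂ → ℂ} {φs : Tc → ℂ} {α : ℂ} {u : Tc → ℝ} (h : OD φ φs α u) {f : ℂ → ℂ}
    {R : ℝ} (hR : 1 < R) (hf : DifferentiableOn ℂ f (ball 0 R)) :
    ∫ θ, φs θ * f (bd θ) ∂m = φ 0 * f 0 := by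
  have hc := cont_circ hR hf
  obtain ⟨C, hC⟩ := bdd_circ hc
  have lim : Tendsto (fun j => ∫ θ, φ (rs j * bd θ) * f (bd θ) ∂m) atTop
      (nhds (∫ θ, φs θ * f (bd θ) ∂m)) := by
    apply tendsto_integral_of_dominated_convergence (fun _ => C)
    · intro j; exact ((h.cont_r j).mul hc).aestronglyMeasurable
    · exact integrable_const _
    · intro j
      filter_upwards with θ
      rw [norm_mul]
      have h1 := h.phi_le (norm_mul_bd_lt (rs_nonneg j) (rs_lt j) θ)
      calc _ ≤ 1 * C := by gcongr; exact hC θ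
        _ = C := one_mul C
    · filter_upwards [h.bdry_seq] with θ hθ
      exact hθ.mul_const _
  refine tendsto_nhds_unique lim (tendsto_const_nhds.congr fun j => ?_)
  rw [integral_bd (fun z => φ (rs j * z) * f z)]
  have hd : DiffContOnCl ℂ (fun z => φ (rs j * z) * f z) (ball 0 |1|) := by
    apply DifferentiableOn.diffContOnCl
    rw [abs_one, closure_ball _ one_ne_zero]
    apply DifferentiableOn.mul
    · refine h.hol.comp (by fun_prop) ?_
      intro z hz
      have : ‖z‖ ≤ 1 := by simpa using hz
      rw [mem_disc, norm_mul, norm_real, Real.norm_of_nonneg (rs_nonneg j)]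
      nlinarith [rs_lt j, rs_pos j]
    · exact hf.mono (closedBall_subset_ball hR)
  rw [hd.circleAverage]
  simp


theorem OD.approx {φ : ℂ → ℂ} {φs : Tc → ℂ} {α : ℂ} {u : Tc → ℝ} (h : OD φ φs α u) {ε : ℝ}
    (hε : 0 < ε) : ∃ (R : ℝ) (f : ℂ → ℂ), 1 < R ∧ DifferentiableOn ℂ f (ball 0 R) ∧
      ∫ θ, ‖α - φs θ * f (bd θ)‖ ^ 2 ∂m ≤ ε := by
  -- truncation level
  have hmaxi : ∀ N : ℕ, Integrable (fun θ => max (u θ) (-(N : ℝ))) m := fun N =>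
    h.int.sup (integrable_const _)
  have hN : Tendsto (fun N : ℕ => ∫ θ, (u θ - max (u θ) (-(N : ℝ))) ∂m) atTop (nhds 0) := by
    rw [← integral_zero Tc ℝ (μ := m)]
    apply tendsto_integral_of_dominated_convergence (fun θ => |u θ|)
    · intro N; exact (h.int.sub (hmaxi N)).aestronglyMeasurable
    · exact h.int.norm
    · intro N
      filter_upwards [h.u_le] with θ hθ
      have h1 : u θ ≤ max (u θ) (-(N : ℝ)) := le_max_left _ _
      have h2 : max (u θ) (-(N : ℝ)) ≤ 0 := max_le hθ (by simp)
      rw [Real.norm_eq_abs, abs_of_nonpos (by linarith), abs_of_nonpos hθ]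
      linarith
    · filter_upwards with θ
      apply tendsto_const_nhds.congr'
      obtain ⟨K, hK⟩ := exists_nat_ge (-u θ)
      filter_upwards [eventually_ge_atTop K] with N hN
      have : (K : ℝ) ≤ N := by exact_mod_cast hN
      rw [max_eq_left (by linarith), sub_self]
  have hN2 : Tendsto (fun N : ℕ => 2 - 2 * Real.exp (∫ θ, (u θ - max (u θ) (-(N : ℝ))) ∂m)) atTop
      (nhds 0) := by
    have := (((Real.continuous_exp.tendsto _).comp hN).const_mul 2).const_sub 2
    simpa using this
  obtain ⟨N, hNε⟩ := (hN2.eventually_lt_const (half_pos hε)).exists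
  set v : Tc → ℝ := fun θ => max (u θ) (-(N : ℝ)) with hv
  have hvi : Integrable v m := hmaxi N
  have huv : ∀ θ, u θ ≤ v θ := fun θ => le_max_left _ _
  have hvN : ∀ θ, -(N : ℝ) ≤ v θ := fun θ => le_max_right _ _
  set M : ℝ := Real.exp N with hM
  have hM0 : 0 < M := Real.exp_pos _
  let f : ℕ → ℂ → ℂ := fun j z => Complex.exp (-Hz v (rs j * z))
  have hfnorm : ∀ j θ, ‖f j (bd θ)‖ = Real.exp (-(Hz v (rs j * bd θ)).re) := by
    intro j θ
    simp only [f]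
    rw [Complex.norm_exp]; simp
  have hfM : ∀ j θ, ‖f j (bd θ)‖ ≤ M := by
    intro j θ
    rw [hfnorm, hM, Real.exp_le_exp]
    have hz := norm_mul_bd_lt (rs_nonneg j) (rs_lt j) θ
    have := Hz_re_mono hz (integrable_const (-(N : ℝ))) hvi (Eventually.of_forall hvN)
    rw [Hz_const_re hz] at this
    linarith
  have hprod : ∀ j θ, ‖φ (rs j * bd θ)‖ * ‖f j (bd θ)‖ ≤ 1 := by
    intro j θ
    have hz := norm_mul_bd_lt (rs_nonneg j) (rs_lt j) θ
    rw [hfnorm, h.norm_eq hz, ← Real.exp_add, Real.exp_le_one_iff]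
    have := Hz_re_mono hz h.int hvi (Eventually.of_forall huv)
    linarith
  have hRR : ∀ j, 1 < (rs j)⁻¹ := fun j => (one_lt_inv₀ (rs_pos j)).2 (rs_lt j)
  have hfd : ∀ j, DifferentiableOn ℂ (f j) (ball 0 (rs j)⁻¹) := by
    intro j
    have : DifferentiableOn ℂ (fun z => Hz v (rs j * z)) (ball 0 (rs j)⁻¹) := by
      refine (Hz_diff hvi).comp (by fun_prop) ?_
      intro z hz
      have hz' : ‖z‖ < (rs j)⁻¹ := by simpa using hz
      rw [mem_disc, norm_mul, norm_real, Real.norm_of_nonneg (rs_nonneg j)]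
      calc rs j * ‖z‖ < rs j * (rs j)⁻¹ := by gcongr; exact rs_pos j
        _ = 1 := mul_inv_cancel₀ (rs_pos j).ne'
    exact this.neg.cexp
  have hfc : ∀ j, Continuous (fun θ => f j (bd θ)) := fun j => cont_circ (hRR j) (hfd j)
  -- limit
  have hlim : Tendsto (fun j => ∫ θ, (1 + M * ‖φs θ - φ (rs j * bd θ)‖) ^ 2 ∂m) atTop (nhds 1) := by
    have e : ∫ θ : Tc, (1 : ℝ) ∂m = 1 := by simp
    refine Tendsto.mono_right (y := nhds (∫ θ : Tc, (1 : ℝ) ∂m)) ?_ (le_of_eq (congrArg nhds e))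
    apply tendsto_integral_of_dominated_convergence (fun _ => (1 + M * 2) ^ 2)
    · intro j
      have h1 : AEStronglyMeasurable (fun θ => ‖φs θ - φ (rs j * bd θ)‖) m :=
        (h.aesm.sub (h.cont_r j).aestronglyMeasurable).norm
      exact ((h1.const_mul M).const_add 1).pow 2
    · exact integrable_const _
    · intro j
      filter_upwards [h.le_one] with θ hθ
      have h1 := h.phi_le (norm_mul_bd_lt (rs_nonneg j) (rs_lt j) θ)
      have h2 := norm_sub_le (φs θ) (φ (rs j * bd θ))
      rw [Real.norm_of_nonneg (by positivity)]
      gcongr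
      linarith
    · filter_upwards [h.bdry_seq] with θ hθ
      have h1 := ((((hθ.const_sub (φs θ)).norm).const_mul M).const_add 1).pow 2
      simpa using h1
  obtain ⟨j, hj⟩ := (hlim.eventually_lt_const (show (1 : ℝ) < 1 + ε / 2 by linarith)).exists
  refine ⟨(rs j)⁻¹, f j, hRR j, hfd j, ?_⟩
  have hgm : AEStronglyMeasurable (fun θ => φs θ * f j (bd θ)) m :=
    h.aesm.mul (hfc j).aestronglyMeasurable
  have hgb : ∀ᵐ θ ∂m, ‖φs θ * f j (bd θ)‖ ≤ M := by
    filter_upwards [h.le_one] with θ hθ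
    rw [norm_mul]
    calc _ ≤ 1 * M := by gcongr; exact hfM j θ
      _ = M := one_mul M
  have hgi : Integrable (fun θ => φs θ * f j (bd θ)) m :=
    (integrable_const M).mono' hgm hgb
  have hg2i : Integrable (fun θ => ‖φs θ * f j (bd θ)‖ ^ 2) m := by
    refine (integrable_const (M ^ 2)).mono' (hgm.norm.pow 2) ?_
    filter_upwards [hgb] with θ hθ
    rw [Real.norm_of_nonneg (by positivity)]
    gcongr
  have hsq : ∫ θ, ‖φs θ * f j (bd θ)‖ ^ 2 ∂m ≤ 1 + ε / 2 := by
    refine le_trans (integral_mono_ae hg2i ?_ ?_) hj.le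
    · refine (integrable_const ((1 + M * 2) ^ 2)).mono' ?_ ?_
      · have h1 : AEStronglyMeasurable (fun θ => ‖φs θ - φ (rs j * bd θ)‖) m :=
          (h.aesm.sub (h.cont_r j).aestronglyMeasurable).norm
        exact ((h1.const_mul M).const_add 1).pow 2
      · filter_upwards [h.le_one] with θ hθ
        have h1 := h.phi_le (norm_mul_bd_lt (rs_nonneg j) (rs_lt j) θ)
        have h2 := norm_sub_le (φs θ) (φ (rs j * bd θ))
        rw [Real.norm_of_nonneg (by positivity)]
        gcongr
        linarith
    · filter_upwards with θ
      have e : φs θ * f j (bd θ) = φ (rs j * bd θ) * f j (bd θ) + (φs θ - φ (rs j * bd θ)) * f j (bd θ) := by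
        ring
      have h1 := norm_add_le (φ (rs j * bd θ) * f j (bd θ)) ((φs θ - φ (rs j * bd θ)) * f j (bd θ))
      rw [← e, norm_mul (φ _), norm_mul (_ - _)] at h1
      have h2 := hprod j θ
      have h3 := mul_le_mul_of_nonneg_left (hfM j θ) (norm_nonneg (φs θ - φ (rs j * bd θ)))
      have h4 : ‖φs θ * f j (bd θ)‖ ≤ 1 + M * ‖φs θ - φ (rs j * bd θ)‖ := by linarith
      gcongr
  have hmean := h.mean (hRR j) (hfd j)
  have hmean2 : φ 0 * f j 0 = α * (Real.exp (∫ θ, (u θ - v θ) ∂m) : ℂ) := by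
    rw [h.rep 0 (by simp)]
    simp only [f, mul_zero]
    rw [Hz_zero, Hz_zero, mul_assoc, ← Complex.exp_add, integral_sub h.int hvi, Complex.ofReal_exp]
    push_cast
    congr 2
  have hαα : conj α * α = 1 := by
    rw [mul_comm, mul_conj, normSq_eq_norm_sq, h.norm_α]; simp
  have hpt : ∀ θ, ‖α - φs θ * f j (bd θ)‖ ^ 2 =
      1 + ‖φs θ * f j (bd θ)‖ ^ 2 - 2 * (conj α * (φs θ * f j (bd θ))).re := by
    intro θ
    rw [← normSq_eq_norm_sq, ← normSq_eq_norm_sq, normSq_sub, normSq_eq_norm_sq α, h.norm_α]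
    have : (α * conj (φs θ * f j (bd θ))).re = (conj α * (φs θ * f j (bd θ))).re := by
      rw [← conj_re]; simp
    rw [this]; ring
  have hci : Integrable (fun θ => conj α * (φs θ * f j (bd θ))) m := hgi.const_mul _
  have hre : ∫ θ, (conj α * (φs θ * f j (bd θ))).re ∂m = Real.exp (∫ θ, (u θ - v θ) ∂m) := by
    have := integral_re hci
    simp only [RCLike.re_to_complex] at this
    rw [this, integral_const_mul, hmean, hmean2, ← mul_assoc, hαα, one_mul, ofReal_re]
  simp_rw [hpt]
  have hrei : Integrable (fun θ => 2 * (conj α * (φs θ * f j (bd θ))).re) m := hci.re.const_mul 2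
  have h1i : Integrable (fun θ => 1 + ‖φs θ * f j (bd θ)‖ ^ 2) m := (integrable_const 1).add hg2i
  rw [integral_sub h1i hrei, integral_add (integrable_const 1) hg2i, integral_const_mul, hre]
  simp only [integral_const, probReal_univ, smul_eq_mul, mul_one]
  simp only [hv] at hNε ⊢
  linarith

theorem OD.key {φ : ℂ → ℂ} {φs : Tc → ℂ} {α : ℂ} {u : Tc → ℝ} (h : OD φ φs α u) {F : Tc → ℂ}
    (hF : MemLp F 2 m) (hz : ∀ n : ℕ, ∫ θ, conj (φs θ * bd θ ^ n) * F θ ∂m = 0) (n : ℕ) :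
    ∫ θ, conj (bd θ ^ n) * F θ ∂m = 0 := by
  have hFi : Integrable F m := hF.integrable one_le_two
  have hF2 : Integrable (fun θ => ‖F θ‖ ^ 2) m := hF.norm.integrable_sq
  have hbn : ∀ n, Continuous (fun θ => bd θ ^ n) := fun n => continuous_bd.pow n
  -- step 1 : orthogonality to all f
  have step1 : ∀ (R : ℝ) (f : ℂ → ℂ), 1 < R → DifferentiableOn ℂ f (ball 0 R) →
      ∫ θ, conj (φs θ * bd θ ^ n * f (bd θ)) * F θ ∂m = 0 := by
    intro R f hR hf
    have hsum : ∀ z : ℂ, ‖z‖ ≤ 1 → HasSum (fun k : ℕ => ((k.factorial : ℂ)⁻¹ * iteratedDeriv k f 0) * z ^ k) (f z) := by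
      intro z hz
      have := Complex.hasSum_taylorSeries_on_ball (f := f) (c := 0) (r := R) hf (z := z) (by simp; linarith)
      refine this.congr_fun fun k => ?_
      simp; ring
    set c : ℕ → ℂ := fun k : ℕ => ((k.factorial : ℂ)⁻¹ * iteratedDeriv k f 0) with hc
    have hcs : Summable (fun k => ‖c k‖) := by
      have := (hsum 1 (by simp)).summable
      simp only [one_pow, mul_one] at this
      exact this.norm
    have hs := hasSum_integral_of_dominated_convergence (μ := m)
      (F := fun k θ => conj (c k) * (conj (φs θ * bd θ ^ (n + k)) * F θ))
      (f := fun θ => conj (φs θ * bd θ ^ n * f (bd θ)) * F θ)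
      (bound := fun k θ => ‖c k‖ * ‖F θ‖) ?_ ?_ ?_ ?_ ?_
    · refine hs.unique ?_
      have : ∀ k, ∫ θ, conj (c k) * (conj (φs θ * bd θ ^ (n + k)) * F θ) ∂m = 0 := by
        intro k
        rw [integral_const_mul, hz, mul_zero]
      simp_rw [this]
      exact hasSum_zero
    · intro k
      refine AEStronglyMeasurable.const_mul (AEStronglyMeasurable.mul ?_ hFi.aestronglyMeasurable) _
      exact continuous_conj.comp_aestronglyMeasurable (h.aesm.mul (hbn _).aestronglyMeasurable)
    · intro k
      filter_upwards [h.le_one] with θ hθ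
      simp only [norm_mul, RCLike.norm_conj, norm_pow, norm_bd, one_pow, mul_one]
      gcongr
      calc _ ≤ 1 * ‖F θ‖ := by gcongr
        _ = _ := one_mul _
    · filter_upwards with θ
      exact hcs.mul_right _
    · simp_rw [tsum_mul_right]
      exact hFi.norm.const_mul _
    · filter_upwards with θ
      have h1 : HasSum (fun k => c k * bd θ ^ k) (f (bd θ)) := hsum (bd θ) (by simp)
      have h2 : HasSum (fun k => conj (c k * bd θ ^ k)) (conj (f (bd θ))) :=
        (Complex.hasSum_conj' (L := SummationFilter.unconditional ℕ)).2 (by simpa using h1)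
      have h3 := h2.mul_left (conj (φs θ * bd θ ^ n) * F θ)
      have e1 : conj (φs θ * bd θ ^ n * f (bd θ)) * F θ
          = conj (φs θ * bd θ ^ n) * F θ * conj (f (bd θ)) := by
        simp only [map_mul]; ring
      rw [e1]
      refine h3.congr_fun fun k => ?_
      simp only [map_mul, map_pow, pow_add]; ring
  -- step 2 : approximation
  have hα0 : conj α ≠ 0 := by
    intro h0
    have := h.norm_α
    rw [← RCLike.norm_conj, h0] at this
    simp at this
  set I := ∫ θ, conj (bd θ ^ n) * F θ ∂m with hI
  have bound : ∀ δ : ℝ, 0 < δ → ‖I‖ ≤ δ * (1 + ∫ θ, ‖F θ‖ ^ 2 ∂m) := by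
    intro δ hδ
    obtain ⟨R, f, hR, hf, hap⟩ := h.approx (ε := δ ^ 2) (by positivity)
    have hfc := cont_circ hR hf
    obtain ⟨C, hC⟩ := bdd_circ hfc
    have hgm : AEStronglyMeasurable (fun θ => φs θ * f (bd θ)) m :=
      h.aesm.mul hfc.aestronglyMeasurable
    have hgb : ∀ᵐ θ ∂m, ‖φs θ * f (bd θ)‖ ≤ C := by
      filter_upwards [h.le_one] with θ hθ
      rw [norm_mul]
      calc _ ≤ 1 * C := by gcongr; exact hC θ
        _ = C := one_mul C
    have hdm : AEStronglyMeasurable (fun θ => α - φs θ * f (bd θ)) m := aestronglyMeasurable_const.sub hgm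
    have hdb : ∀ᵐ θ ∂m, ‖α - φs θ * f (bd θ)‖ ≤ 1 + C := by
      filter_upwards [hgb] with θ hθ
      have := norm_sub_le α (φs θ * f (bd θ))
      rw [h.norm_α] at this
      linarith
    have hd2 : Integrable (fun θ => ‖α - φs θ * f (bd θ)‖ ^ 2) m := by
      refine (integrable_const ((1 + C) ^ 2)).mono' (hdm.norm.pow 2) ?_
      filter_upwards [hdb] with θ hθ
      rw [Real.norm_of_nonneg (by positivity)]
      gcongr
    have e0 := step1 R f hR hf
    have i1 : Integrable (fun θ => conj α * (conj (bd θ ^ n) * F θ)) m := by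
      refine Integrable.const_mul ?_ _
      refine hFi.bdd_mul (c := 1) (continuous_conj.comp (hbn n)).aestronglyMeasurable ?_
      filter_upwards with θ
      simp
    have i2 : Integrable (fun θ => conj (φs θ * bd θ ^ n * f (bd θ)) * F θ) m := by
      refine hFi.bdd_mul (c := C) (continuous_conj.comp_aestronglyMeasurable
        ((h.aesm.mul (hbn _).aestronglyMeasurable).mul hfc.aestronglyMeasurable)) ?_
      filter_upwards [hgb] with θ hθ
      rw [norm_mul] at hθ
      simpa using hθ
    have e1 : conj α * I = ∫ θ, conj (bd θ ^ n) * (conj (α - φs θ * f (bd θ)) * F θ) ∂m := by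
      rw [hI, ← integral_const_mul, ← sub_zero (∫ θ, conj α * _ ∂m), ← e0, ← integral_sub i1 i2]
      congr 1; ext θ
      simp; ring
    have e2 : ‖I‖ = ‖conj α * I‖ := by rw [norm_mul, RCLike.norm_conj, h.norm_α, one_mul]
    rw [e2, e1]
    have hb : Integrable (fun θ => δ⁻¹ * ‖α - φs θ * f (bd θ)‖ ^ 2 + δ * ‖F θ‖ ^ 2) m :=
      (hd2.const_mul _).add (hF2.const_mul _)
    refine (norm_integral_le_of_norm_le hb ?_).trans ?_
    · filter_upwards with θ
      simp only [norm_mul, RCLike.norm_conj, norm_pow, norm_bd, one_pow, one_mul]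
      set x := ‖α - φs θ * f (bd θ)‖
      set y := ‖F θ‖
      have hx : 0 ≤ x := norm_nonneg _
      have hy : 0 ≤ y := norm_nonneg _
      have h1 : 0 ≤ δ⁻¹ * (x - δ * y) ^ 2 := by positivity
      have h2 : δ⁻¹ * (x - δ * y) ^ 2 = δ⁻¹ * x ^ 2 + δ * y ^ 2 - 2 * (x * y) := by
        field_simp; ring
      nlinarith [mul_nonneg hx hy]
    · rw [integral_add (hd2.const_mul _) (hF2.const_mul _), integral_const_mul, integral_const_mul]
      have : δ⁻¹ * ∫ θ, ‖α - φs θ * f (bd θ)‖ ^ 2 ∂m ≤ δ⁻¹ * δ ^ 2 := by gcongr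
      have e : δ⁻¹ * δ ^ 2 = δ := by field_simp
      linarith
  have hK : 0 ≤ ∫ θ, ‖F θ‖ ^ 2 ∂m := integral_nonneg fun _ => by positivity
  by_contra hne
  have hpos : 0 < ‖I‖ := norm_pos_iff.2 hne
  have := bound (‖I‖ / (2 * (1 + ∫ θ, ‖F θ‖ ^ 2 ∂m))) (by positivity)
  have e : ‖I‖ / (2 * (1 + ∫ θ, ‖F θ‖ ^ 2 ∂m)) * (1 + ∫ θ, ‖F θ‖ ^ 2 ∂m) = ‖I‖ / 2 := by
    field_simp
  linarith

theorem OD.memLp {φ : ℂ → ℂ} {φs : Tc → ℂ} {α : ℂ} {u : Tc → ℝ} (h : OD φ φs α u) (n : ℕ) :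
    MemLp (fun θ => φs θ * bd θ ^ n) 2 m := by
  refine MemLp.of_bound (C := 1) (h.aesm.mul (continuous_bd.pow n).aestronglyMeasurable) ?_
  filter_upwards [h.le_one] with θ hθ
  simpa using hθ

/-- The `L²` element `φ z^n`. -/
def OD.V {φ : ℂ → ℂ} {φs : Tc → ℂ} {α : ℂ} {u : Tc → ℝ} (h : OD φ φs α u) (n : ℕ) : L2 :=
  (h.memLp n).toLp _

theorem OD.V_ae {φ : ℂ → ℂ} {φs : Tc → ℂ} {α : ℂ} {u : Tc → ℝ} (h : OD φ φs α u) (n : ℕ) :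
    (h.V n : Tc → ℂ) =ᵐ[m] fun θ => φs θ * bd θ ^ n := (h.memLp n).coeFn_toLp

theorem inner_int (F G : L2) : inner ℂ F G = ∫ θ, conj ((F : Tc → ℂ) θ) * (G : Tc → ℂ) θ ∂m := by
  rw [L2.inner_def]
  simp only [RCLike.inner_apply']

theorem OD.inner_V {φ : ℂ → ℂ} {φs : Tc → ℂ} {α : ℂ} {u : Tc → ℝ} (h : OD φ φs α u) (n : ℕ)
    (F : L2) : inner ℂ (h.V n) F = ∫ θ, conj (φs θ * bd θ ^ n) * (F : Tc → ℂ) θ ∂m := by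
  rw [inner_int]
  apply integral_congr_ae
  filter_upwards [h.V_ae n] with θ hθ
  rw [hθ]

theorem fourier_memLp (k : ℤ) : MemLp (fun θ : Tc => (fourier k θ : ℂ)) 2 m := by
  refine MemLp.of_bound (C := 1) (fourier k).continuous.aestronglyMeasurable ?_
  filter_upwards with θ
  rw [fourier_apply, Circle.norm_coe]

/-- The exponentials. -/
def Em (k : ℤ) : L2 := (fourier_memLp k).toLp _

theorem Em_ae (k : ℤ) : (Em k : Tc → ℂ) =ᵐ[m] fun θ => fourier k θ := (fourier_memLp k).coeFn_toLp

theorem inner_Em (k : ℤ) (F : L2) : inner ℂ (Em k) F = fourierCoeff (F : Tc → ℂ) k := by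
  rw [inner_int, fourierCoeff]
  show _ = ∫ θ, _ ∂m
  apply integral_congr_ae
  filter_upwards [Em_ae k] with θ hθ
  rw [hθ, fourier_neg, smul_eq_mul]

theorem Em_orth (k l : ℤ) : inner ℂ (Em k) (Em l) = if k = l then 1 else 0 := by
  rw [inner_Em, fourierCoeff_congr_ae (Em_ae l), ]
  have := fourierCoeff_fourier (T := 2 * Real.pi) l
  rw [show (fun θ : Tc => (fourier l θ : ℂ)) = ⇑(fourier l : C(Tc, ℂ)) from rfl, this]
  simp [Pi.single_apply]

theorem L2_eq_zero (F : L2) (h : ∀ k : ℤ, fourierCoeff (F : Tc → ℂ) k = 0) : F = 0 := by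
  have key : ∀ F : Lp ℂ 2 (AddCircle.haarAddCircle : Measure Tc),
      (∀ k : ℤ, fourierCoeff (F : Tc → ℂ) k = 0) → F = 0 := by
    intro F h
    apply fourierBasis.repr.injective
    rw [map_zero]
    ext k
    rw [fourierBasis_repr, h]; rfl
  exact key F h

theorem mem_H2 (F : L2) : F ∈ H2 ↔ ∀ k : ℤ, k < 0 → inner ℂ (Em k) F = 0 := by
  simp only [inner_Em]; rfl

theorem OD.key' {φ : ℂ → ℂ} {φs : Tc → ℂ} {α : ℂ} {u : Tc → ℝ} (h : OD φ φs α u)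
    (F : L2) (hF : F ∈ H2) (hz : ∀ n, inner ℂ (h.V n) F = 0) : F = 0 := by
  apply L2_eq_zero
  intro k
  rcases lt_or_ge k 0 with hk | hk
  · exact hF k hk
  · lift k to ℕ using hk
    have := h.key (Lp.memLp F) (fun n => by rw [← h.inner_V, hz]) k
    rw [fourierCoeff]
    show ∫ θ, _ ∂m = 0
    rw [← this]
    congr 1; ext θ
    rw [fourier_neg, fourier_eq_bd, smul_eq_mul]

theorem OD.V_coeff {φ : ℂ → ℂ} {φs : Tc → ℂ} {α : ℂ} {u : Tc → ℝ} (h : OD φ φs α u)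
    (n : ℕ) (k : ℤ) (hk : k < n) : inner ℂ (Em k) (h.V n) = 0 := by
  rw [inner_int]
  obtain ⟨j, hj⟩ : ∃ j : ℕ, (n : ℤ) = k + (j + 1 : ℕ) := ⟨(n - k - 1).toNat, by push_cast; omega⟩
  have := h.mean (R := 2) (f := fun z => z ^ (j + 1)) (by norm_num) (by fun_prop)
  rw [zero_pow (by omega), mul_zero] at this
  rw [← this]
  apply integral_congr_ae
  filter_upwards [h.V_ae n, Em_ae k] with θ h1 h2
  rw [h1, h2, ← fourier_eq_bd, ← fourier_eq_bd, hj, fourier_add, ← fourier_neg]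
  have : fourier (-k) θ * fourier k θ = (1 : ℂ) := by
    rw [← fourier_add]; simp
  linear_combination (φs θ * fourier ((j + 1 : ℕ) : ℤ) θ) * this

theorem OD.V_H2 {φ : ℂ → ℂ} {φs : Tc → ℂ} {α : ℂ} {u : Tc → ℝ} (h : OD φ φs α u)
    (n : ℕ) : h.V n ∈ H2 := by
  rw [mem_H2]
  intro k hk
  exact h.V_coeff n k (by omega)

theorem hb_iff (P : BPair) {α β : ℂ} {u v : Tc → ℝ} (ha : OD P.a P.as' α u) (hb : OD P.b P.bs β v)
    (F G : L2) : HbMem P F G ↔ (∀ k : ℤ, k < 0 → inner ℂ (Em k) F = 0) ∧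
      (∀ k : ℤ, k < 0 → inner ℂ (Em k) G = 0) ∧
      ∀ n : ℕ, inner ℂ (hb.V n) F = inner ℂ (ha.V n) G := by
  rw [HbMem, mem_H2, mem_H2]
  have e : ∀ n : ℕ, fourierCoeff (fun θ => conj (P.bs θ) * (F : Tc → ℂ) θ
      - conj (P.as' θ) * (G : Tc → ℂ) θ) n = inner ℂ (hb.V n) F - inner ℂ (ha.V n) G := by
    intro n
    have hi : ∀ (H K : L2), Integrable (fun θ => conj ((H : Tc → ℂ) θ) * (K : Tc → ℂ) θ) m := by
      intro H K
      have := L2.integrable_inner (𝕜 := ℂ) H K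
      simpa only [RCLike.inner_apply'] using this
    rw [inner_int, inner_int, ← integral_sub (hi _ _) (hi _ _), fourierCoeff]
    show ∫ θ, _ ∂m = _
    apply integral_congr_ae
    filter_upwards [ha.V_ae n, hb.V_ae n] with θ h1 h2
    rw [h1, h2, fourier_neg, fourier_eq_bd, smul_eq_mul, map_mul, map_mul]
    ring
  refine and_congr_right fun _ => and_congr_right fun _ => ⟨fun h n => ?_, fun h n hn => ?_⟩
  · have := h n (by omega)
    rw [e] at this
    exact sub_eq_zero.1 this
  · lift n to ℕ using hn
    rw [e, h, sub_self]

theorem inner_HbP (p q : HbP) :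
    inner ℂ p q = inner ℂ (fst2 p) (fst2 q) + inner ℂ (snd2 p) (snd2 q) :=
  WithLp.prod_inner_apply p q

/-- `H(b)` as a closed subspace. -/
def HbSub (P : BPair) {α β : ℂ} {u v : Tc → ℝ} (ha : OD P.a P.as' α u)
    (hb : OD P.b P.bs β v) : Submodule ℂ HbP where
  carrier := HbSet P
  zero_mem' := by
    show HbMem P 0 0
    rw [hb_iff P ha hb]
    simp
  add_mem' := by
    intro p q hp hq
    have hp' : HbMem P (fst2 p) (snd2 p) := hp
    have hq' : HbMem P (fst2 q) (snd2 q) := hq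
    show HbMem P (fst2 p + fst2 q) (snd2 p + snd2 q)
    rw [hb_iff P ha hb] at *
    obtain ⟨h1, h2, h3⟩ := hp'
    obtain ⟨g1, g2, g3⟩ := hq'
    refine ⟨fun k hk => ?_, fun k hk => ?_, fun n => ?_⟩
    · rw [inner_add_right, h1 k hk, g1 k hk, add_zero]
    · rw [inner_add_right, h2 k hk, g2 k hk, add_zero]
    · rw [inner_add_right, inner_add_right, h3, g3]
  smul_mem' := by
    intro c p hp
    have hp' : HbMem P (fst2 p) (snd2 p) := hp
    show HbMem P (c • fst2 p) (c • snd2 p)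
    rw [hb_iff P ha hb] at *
    obtain ⟨h1, h2, h3⟩ := hp'
    refine ⟨fun k hk => ?_, fun k hk => ?_, fun n => ?_⟩
    · rw [inner_smul_right, h1 k hk, mul_zero]
    · rw [inner_smul_right, h2 k hk, mul_zero]
    · rw [inner_smul_right, inner_smul_right, h3]

theorem continuous_fst2 : Continuous fst2 := continuous_fst.comp (WithLp.prod_continuous_ofLp 2 _ _)
theorem continuous_snd2 : Continuous snd2 := continuous_snd.comp (WithLp.prod_continuous_ofLp 2 _ _)

theorem HbSet_closed (P : BPair) {α β : ℂ} {u v : Tc → ℝ} (ha : OD P.a P.as' α u)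
    (hb : OD P.b P.bs β v) : IsClosed (HbSet P) := by
  have : HbSet P = {p : HbP | (∀ k : ℤ, k < 0 → inner ℂ (Em k) (fst2 p) = 0) ∧
      (∀ k : ℤ, k < 0 → inner ℂ (Em k) (snd2 p) = 0) ∧
      ∀ n : ℕ, inner ℂ (hb.V n) (fst2 p) = inner ℂ (ha.V n) (snd2 p)} := by
    ext p
    exact hb_iff P ha hb _ _
  rw [this]
  have c1 : ∀ x : L2, Continuous fun p : HbP => inner ℂ x (fst2 p) := fun x =>
    continuous_const.inner continuous_fst2
  have c2 : ∀ x : L2, Continuous fun p : HbP => inner ℂ x (snd2 p) := fun x =>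
    continuous_const.inner continuous_snd2
  simp only [ofPred_and, ofPred_forall]
  refine IsClosed.inter ?_ (IsClosed.inter ?_ ?_)
  · exact isClosed_iInter fun k => isClosed_iInter fun _ => isClosed_eq (c1 _) continuous_const
  · exact isClosed_iInter fun k => isClosed_iInter fun _ => isClosed_eq (c2 _) continuous_const
  · exact isClosed_iInter fun k => isClosed_eq (c1 _) (c2 _)

theorem pyth_orth (P : BPair) {α β : ℂ} {u v : Tc → ℝ} (ha : OD P.a P.as' α u)
    (hb : OD P.b P.bs β v) (n N : ℕ) :
    inner ℂ (hb.V n) (hb.V N) + inner ℂ (ha.V n) (ha.V N) = if n = N then 1 else 0 := by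
  have hi : ∀ (H K : L2), Integrable (fun θ => conj ((H : Tc → ℂ) θ) * (K : Tc → ℂ) θ) m := by
    intro H K
    have := L2.integrable_inner (𝕜 := ℂ) H K
    simpa only [RCLike.inner_apply'] using this
  have e : inner ℂ (Em n) (Em N) = if n = N then (1 : ℂ) else 0 := by
    rw [Em_orth]; simp
  rw [← e, inner_int, inner_int, inner_int, ← integral_add (hi _ _) (hi _ _)]
  apply integral_congr_ae
  filter_upwards [ha.V_ae n, hb.V_ae n, ha.V_ae N, hb.V_ae N, Em_ae n, Em_ae N, P.pyth]
    with θ h1 h2 h3 h4 h5 h6 h7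
  rw [h1, h2, h3, h4, h5, h6, fourier_eq_bd, fourier_eq_bd, map_mul, map_mul]
  have e1 := Complex.conj_mul' (P.as' θ)
  have e2 := Complex.conj_mul' (P.bs θ)
  have e3 : (‖P.as' θ‖ : ℂ) ^ 2 + (‖P.bs θ‖ : ℂ) ^ 2 = 1 := by exact_mod_cast h7
  linear_combination (conj (bd θ ^ n) * bd θ ^ N) * (e1 + e2 + e3)

theorem orth_zero (P : BPair) {α β : ℂ} {u v : Tc → ℝ} (ha : OD P.a P.as' α u)
    (hb : OD P.b P.bs β v) (Q : ℕ → HbP) (hQ : ∀ n, Q n ∈ HbSet P)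
    (hQ1 : ∀ n, fst2 (Q n) = hb.V n) (g : HbP) (hg : g ∈ HbSet P)
    (hgQ : ∀ n, inner ℂ (Q n) g = 0) : g = 0 := by
  obtain ⟨g1, g2, g3⟩ := (hb_iff P ha hb _ _).1 hg
  let h : ℕ → L2 := fun N => snd2 (Q N) + ha.V N
  have hh : ∀ N, inner ℂ (h N) (snd2 g) = 0 := by
    intro N
    have := hgQ N
    rw [inner_HbP, hQ1, g3] at this
    simp only [h]
    rw [inner_add_left, ← this, add_comm]
  have hH : ∀ N, ∀ k : ℤ, k < 0 → inner ℂ (Em k) (h N) = 0 := by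
    intro N k hk
    simp only [h]
    rw [inner_add_right, ((hb_iff P ha hb _ _).1 (hQ N)).2.1 k hk,
      ha.V_coeff N k (by omega), add_zero]
  have hA : ∀ n N, inner ℂ (ha.V n) (h N) = if n = N then 1 else 0 := by
    intro n N
    simp only [h]
    rw [inner_add_right, ← ((hb_iff P ha hb _ _).1 (hQ N)).2.2 n, hQ1, pyth_orth]
  have hE : ∀ N : ℕ, Em N = ∑ j ∈ Finset.range (N + 1), inner ℂ (ha.V j) (Em N) • h j := by
    intro N
    rw [← sub_eq_zero]
    apply ha.key'
    · rw [mem_H2]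
      intro k hk
      rw [inner_sub_right, inner_sum, Finset.sum_eq_zero, Em_orth, if_neg (by omega), sub_zero]
      intro j _
      rw [inner_smul_right, hH j k hk, mul_zero]
    · intro n
      rw [inner_sub_right, inner_sum]
      simp only [inner_smul_right, hA, mul_ite, mul_one, mul_zero, Finset.sum_ite_eq,
        Finset.mem_range]
      split_ifs with hn
      · exact sub_self _
      · rw [sub_zero, ← inner_conj_symm, ha.V_coeff n N (by omega), map_zero]
  have hg2 : snd2 g = 0 := by
    apply L2_eq_zero
    intro k
    rw [← inner_Em]
    rcases lt_or_ge k 0 with hk | hk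
    · exact g2 k hk
    · lift k to ℕ using hk
      rw [hE k, sum_inner]
      apply Finset.sum_eq_zero
      intro j _
      rw [inner_smul_left, hh, mul_zero]
  have hg1 : fst2 g = 0 := by
    apply hb.key'
    · exact (mem_H2 _).2 g1
    · intro n
      rw [g3, hg2, inner_zero_right]
  have : inner ℂ g g = 0 := by
    rw [inner_HbP, hg1, hg2, inner_zero_right, add_zero]
  exact inner_self_eq_zero.1 this

/-- Assume `b` is outer. Then for every `λ ∈ 𝔻`, the function `b·k_λ` is
cyclic for `S_b`. -/
theorem stmt_18 (P : BPair) (hbout : OuterFn P.b) (lam : ℂ) (hlam : lam ∈ uDisc)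
    (q : HbP) (hq : q ∈ HbSet P)
    (hbd : (fst2 q : Tc → ℂ) =ᵐ[m] fun θ => P.bs θ * ker lam (bd θ)) :
    CyclicSb P q := by
  have hale : ∀ᵐ θ ∂m, ‖P.as' θ‖ ≤ 1 := by
    filter_upwards [P.pyth] with θ hθ
    nlinarith [norm_nonneg (P.as' θ), sq_nonneg ‖P.bs θ‖]
  have hble : ∀ᵐ θ ∂m, ‖P.bs θ‖ ≤ 1 := by
    filter_upwards [P.pyth] with θ hθ
    nlinarith [norm_nonneg (P.bs θ), sq_nonneg ‖P.as' θ‖]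
  obtain ⟨α, u, ha⟩ := exists_OD P.a_outer P.a_bdry hale
  obtain ⟨β, v, hb⟩ := exists_OD hbout P.b_bdry hble
  refine ⟨hq, fun Zf hZ => ?_⟩
  have hZm : ∀ n, Zf n ∈ HbSub P ha hb := fun n => (hZ n).1
  set S : Submodule ℂ HbP := Submodule.span ℂ (Set.range Zf) with hS
  have hSle : S ≤ HbSub P ha hb := by
    rw [hS, Submodule.span_le]
    rintro _ ⟨n, rfl⟩
    exact hZm n
  apply Set.Subset.antisymm
  · exact closure_minimal hSle (HbSet_closed P ha hb)
  · intro p hp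
    rw [← Submodule.topologicalClosure_coe]
    set W := S.topologicalClosure with hW
    have hWc : IsClosed (W : Set HbP) := S.isClosed_topologicalClosure
    have : CompleteSpace W := hWc.completeSpace_coe
    have hWle : W ≤ HbSub P ha hb :=
      S.topologicalClosure_minimal hSle (HbSet_closed P ha hb)
    obtain ⟨y, hy, z, hz, hpz⟩ := W.exists_add_mem_mem_orthogonal p
    have hpS : p ∈ HbSub P ha hb := hp
    have hzH : z ∈ HbSub P ha hb := by
      have : z = p - y := by rw [hpz]; abel
      rw [this]
      exact Submodule.sub_mem _ hpS (hWle hy)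
    have hZW : ∀ n, Zf n ∈ W := fun n =>
      S.le_topologicalClosure (Submodule.subset_span ⟨n, rfl⟩)
    have hz0 : z = 0 := by
      refine orth_zero P ha hb (fun n => Zf n - conj lam • Zf (n + 1)) ?_ ?_ z hzH ?_
      · intro n
        exact Submodule.sub_mem _ (hZm n) (Submodule.smul_mem _ _ (hZm (n + 1)))
      · intro n
        have e : fst2 (Zf n - conj lam • Zf (n + 1)) = fst2 (Zf n) - conj lam • fst2 (Zf (n + 1)) :=
          rfl
        simp only [e]
        apply Lp.ext
        filter_upwards [Lp.coeFn_sub (fst2 (Zf n)) (conj lam • fst2 (Zf (n + 1))),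
          Lp.coeFn_smul (conj lam) (fst2 (Zf (n + 1))), (hZ n).2, (hZ (n + 1)).2, hbd, hb.V_ae n]
          with θ h1 h2 h3 h4 h5 h6
        rw [h1, Pi.sub_apply, h2, Pi.smul_apply, h3, h4, h5, h6, smul_eq_mul, _root_.ker]
        have hne : 1 - conj lam * bd θ ≠ 0 := by
          intro h0
          have h7 : ‖conj lam * bd θ‖ = 1 := by
            rw [← sub_eq_zero.1 h0, norm_one]
          rw [norm_mul, RCLike.norm_conj, norm_bd, mul_one] at h7
          have h8 := mem_disc.1 hlam
          linarith
        have hk := mul_inv_cancel₀ hne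
        rw [pow_succ]
        linear_combination (P.bs θ * bd θ ^ n) * hk
      · intro n
        exact hz _ (W.sub_mem (hZW n) (W.smul_mem _ (hZW (n + 1))))
    rw [hpz, hz0, add_zero]
    exact hy

end
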